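/- There is an absolute constant C ≥ 1 such that the following holds. Let F be a finite field with q elements, n ≥ 1, and suppose A ⊆ 𝔽_q^n has |A| ≥ 2^{−d}·q^n for some real d ≥ 1. Then there is a subset A′ ⊆ A with |A′| ≥ q^{−C·d^9} · q^n such that A′ + A′ + A′ is an affine subspace of 𝔽_q^n, i.e., there exist an F-linear subspace W of 𝔽_q^n and θ ∈ 𝔽_q^n with A′ + A′ + A′ = θ + W. -/

import Mathlib

open Pointwise

section Moments

variable {V : Type*} [AddCommGroup V] [Fintype V]

/-- Unnormalised autocorrelation of a real function on a finite abelian group. -/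
def autocorr (f : V → ℝ) (x : V) : ℝ := ∑ y, f y * f (y + x)

/-- Unnormalised self-convolution of a real function on a finite abelian group. -/
def selfConv (f : V → ℝ) (x : V) : ℝ := ∑ y, f y * f (x - y)

theorem card_mul_sum_autocorr_pow (f : V → ℝ) (p : ℕ) :
    Fintype.card V * ∑ x, autocorr f x ^ p =
      ∑ y : Fin p → V, (∑ z, ∏ i, f (y i + z)) ^ 2 := by
  have h1 : ∀ z : V, ∑ x, autocorr f x ^ p =
      ∑ x, ∑ y : Fin p → V, (∏ i, f (y i + z)) * ∏ i, f (y i + z + x) := by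
    intro z
    refine Finset.sum_congr rfl fun x _ => ?_
    rw [autocorr, Fintype.sum_pow]
    rw [← Equiv.sum_comp (Equiv.addRight (fun _ : Fin p => z))]
    refine Finset.sum_congr rfl fun y _ => ?_
    simp [Finset.prod_mul_distrib]
  calc Fintype.card V * ∑ x, autocorr f x ^ p = ∑ _z : V, ∑ x, autocorr f x ^ p := by simp
    _ = ∑ z : V, ∑ x, ∑ y : Fin p → V, (∏ i, f (y i + z)) * ∏ i, f (y i + z + x) :=
        Finset.sum_congr rfl fun z _ => h1 z
    _ = ∑ z : V, ∑ y : Fin p → V, ∑ x, (∏ i, f (y i + z)) * ∏ i, f (y i + z + x) :=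
        Finset.sum_congr rfl fun z _ => Finset.sum_comm
    _ = ∑ y : Fin p → V, ∑ z : V, ∑ x, (∏ i, f (y i + z)) * ∏ i, f (y i + z + x) :=
        Finset.sum_comm
    _ = _ := by
        refine Finset.sum_congr rfl fun y _ => ?_
        rw [sq, Finset.sum_mul_sum]
        refine Finset.sum_congr rfl fun z _ => ?_
        rw [← Equiv.sum_comp (Equiv.addLeft z) (fun w => (∏ i, f (y i + z)) * ∏ i, f (y i + w))]
        simp [add_assoc]

theorem sum_autocorr_pow_nonneg (f : V → ℝ) (p : ℕ) : 0 ≤ ∑ x, autocorr f x ^ p := by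
  have h : (0 : ℝ) < Fintype.card V := by exact_mod_cast Fintype.card_pos
  refine nonneg_of_mul_nonneg_right (a := (Fintype.card V : ℝ)) ?_ h
  rw [card_mul_sum_autocorr_pow]
  positivity

theorem sum_selfConv_pow_le (f : V → ℝ) (p : ℕ) :
    ∑ x, selfConv f x ^ p ≤ ∑ x, autocorr f x ^ p := by
  have h : (0 : ℝ) < Fintype.card V := by exact_mod_cast Fintype.card_pos
  refine le_of_mul_le_mul_left ?_ h
  rw [card_mul_sum_autocorr_pow]
  set Φ : (Fin p → V) → ℝ := fun y => ∑ z, ∏ i, f (y i + z) with hΦ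
  have h1 : ∀ z : V, ∑ x, selfConv f x ^ p =
      ∑ x, ∑ y : Fin p → V, (∏ i, f (y i + z)) * ∏ i, f (-y i + x) := by
    intro z
    rw [← Equiv.sum_comp (Equiv.addRight z)]
    refine Finset.sum_congr rfl fun x _ => ?_
    rw [selfConv, Fintype.sum_pow]
    rw [← Equiv.sum_comp (Equiv.addRight (fun _ : Fin p => z))]
    refine Finset.sum_congr rfl fun y _ => ?_
    simp only [Equiv.coe_addRight, Pi.add_apply, Finset.prod_mul_distrib]
    congr 1
    refine Finset.prod_congr rfl fun i _ => ?_
    congr 1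
    abel
  have h2 : Fintype.card V * ∑ x, selfConv f x ^ p = ∑ y, Φ y * Φ (-y) := by
    calc Fintype.card V * ∑ x, selfConv f x ^ p = ∑ _z : V, ∑ x, selfConv f x ^ p := by simp
      _ = ∑ z : V, ∑ x, ∑ y : Fin p → V, (∏ i, f (y i + z)) * ∏ i, f (-y i + x) :=
          Finset.sum_congr rfl fun z _ => h1 z
      _ = ∑ z : V, ∑ y : Fin p → V, ∑ x, (∏ i, f (y i + z)) * ∏ i, f (-y i + x) :=
          Finset.sum_congr rfl fun z _ => Finset.sum_comm
      _ = ∑ y : Fin p → V, ∑ z : V, ∑ x, (∏ i, f (y i + z)) * ∏ i, f (-y i + x) :=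
          Finset.sum_comm
      _ = _ := by
          refine Finset.sum_congr rfl fun y _ => ?_
          simp [hΦ, Finset.sum_mul_sum]
  have h3 : ∑ y, Φ (-y) ^ 2 = ∑ y, Φ y ^ 2 := Equiv.sum_comp (Equiv.neg _) (fun y => Φ y ^ 2)
  have h4 : ∑ y, Φ y * Φ (-y) ≤ ∑ y, (Φ y ^ 2 + Φ (-y) ^ 2) / 2 :=
    Finset.sum_le_sum fun y _ => by nlinarith [sq_nonneg (Φ y - Φ (-y))]
  rw [← Finset.sum_div, Finset.sum_add_distrib, h3] at h4
  rw [h2]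
  linarith

theorem four_pow_le_choose (p : ℕ) : 4 ^ p ≤ (4 * p).choose p := by
  induction p with
  | zero => simp
  | succ p ih =>
    have h := Nat.add_one_mul_choose_eq (4 * p + 3) p
    have h1 : (4 * (p + 1)).choose (p + 1) = 4 * (4 * p + 3).choose p := by
      have : (p + 1) * (4 * (p + 1)).choose (p + 1) = (p + 1) * (4 * (4 * p + 3).choose p) := by
        rw [show 4 * (p + 1) = 4 * p + 3 + 1 by ring, mul_comm, ← h]; ring
      exact Nat.eq_of_mul_eq_mul_left (by omega) this
    rw [h1, pow_succ, mul_comm]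
    exact Nat.mul_le_mul_left _ (ih.trans (Nat.choose_le_choose _ (by omega)))

/-- If all power sums of `g` are nonnegative, then adding a positive constant to `g` can be
detected by a single moment. -/
theorem le_sum_const_add_pow {ι : Type*} [Fintype ι] (g : ι → ℝ) (hg : ∀ j, 0 ≤ ∑ x, g x ^ j)
    {c : ℝ} (hc : 0 ≤ c) (p : ℕ) : 4 ^ p * c ^ (3 * p) * ∑ x, g x ^ p ≤ ∑ x, (g x + c) ^ (4 * p) := by
  simp_rw [add_pow]
  rw [Finset.sum_comm]
  have h1 : ∀ j ∈ Finset.range (4 * p + 1),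
      0 ≤ ∑ x, g x ^ j * c ^ (4 * p - j) * ((4 * p).choose j : ℝ) := by
    intro j _
    rw [← Finset.sum_mul, ← Finset.sum_mul]
    have := hg j
    positivity
  refine le_trans ?_ (Finset.single_le_sum h1 (Finset.mem_range.2 (by omega : p < 4 * p + 1)))
  rw [← Finset.sum_mul, ← Finset.sum_mul, show 4 * p - p = 3 * p by omega]
  have h2 : (4 : ℝ) ^ p ≤ (4 * p).choose p := by exact_mod_cast four_pow_le_choose p
  have h3 := hg p
  calc 4 ^ p * c ^ (3 * p) * ∑ x, g x ^ p
      ≤ (4 * p).choose p * c ^ (3 * p) * ∑ x, g x ^ p := by gcongr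
    _ = _ := by ring

theorem autocorr_sub_const (f : V → ℝ) (a : ℝ) (x : V) :
    autocorr (fun y => f y - a) x =
      autocorr f x - 2 * a * ∑ y, f y + Fintype.card V * a ^ 2 := by
  have h : ∑ y, f (y + x) = ∑ y, f y := Equiv.sum_comp (Equiv.addRight x) f
  have h2 : ∀ y, (f y - a) * (f (y + x) - a) = f y * f (y + x) - a * f y - a * f (y + x) + a ^ 2 :=
    fun y => by ring
  simp only [autocorr, h2, Finset.sum_add_distrib, Finset.sum_sub_distrib, ← Finset.mul_sum, h]
  simp
  ring

theorem selfConv_sub_const (f : V → ℝ) (a : ℝ) (x : V) :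
    selfConv (fun y => f y - a) x =
      selfConv f x - 2 * a * ∑ y, f y + Fintype.card V * a ^ 2 := by
  have h : ∑ y, f (x - y) = ∑ y, f y := Equiv.sum_comp (Equiv.subLeft x) f
  have h2 : ∀ y, (f y - a) * (f (x - y) - a) = f y * f (x - y) - a * f y - a * f (x - y) + a ^ 2 :=
    fun y => by ring
  simp only [selfConv, h2, Finset.sum_add_distrib, Finset.sum_sub_distrib, ← Finset.mul_sum, h]
  simp
  ring

end Moments

section Indicators

variable {V : Type*} [DecidableEq V]

/-- The real indicator function of a finite set. -/
def indic (A : Finset V) (x : V) : ℝ := if x ∈ A then 1 else 0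

theorem indic_nonneg (A : Finset V) (x : V) : 0 ≤ indic A x := by
  unfold indic; split_ifs <;> norm_num

theorem indic_le_one (A : Finset V) (x : V) : indic A x ≤ 1 := by
  unfold indic; split_ifs <;> norm_num

variable [Fintype V]

theorem sum_indic (A : Finset V) : ∑ x, indic A x = A.card := by
  simp [indic]

theorem sum_indic_mul (A : Finset V) (f : V → ℝ) : ∑ x, indic A x * f x = ∑ x ∈ A, f x := by
  simp [indic]

variable [AddCommGroup V]

/-- If `A + A + A` misses a point, then the autocorrelation of `A` has a large moment. -/
theorem large_moment_of_notMem (A : Finset V) {p : ℕ} (hp : Even p) {x : V}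
    (hx : x ∉ A + A + A) :
    4 ^ p * ((A.card : ℝ) ^ 2 / Fintype.card V) ^ (4 * p) * A.card ≤
      ∑ y, autocorr (indic A) y ^ (4 * p) := by
  have hN : (0 : ℝ) < Fintype.card V := by exact_mod_cast Fintype.card_pos
  set N : ℝ := (Fintype.card V : ℝ) with hNdef
  set c : ℝ := (A.card : ℝ) ^ 2 / N with hc
  have hc0 : 0 ≤ c := by positivity
  set f : V → ℝ := fun y => indic A y - A.card / N with hf
  have h1 : ∀ y, autocorr (indic A) y = autocorr f y + c := by
    intro y
    rw [hf, autocorr_sub_const, sum_indic, hc]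
    field_simp
    ring
  have h2 : ∀ y, selfConv f y = selfConv (indic A) y - c := by
    intro y
    rw [hf, selfConv_sub_const, sum_indic, hc]
    field_simp
    ring
  have h3 : ∀ a ∈ A, selfConv f (x - a) = - c := by
    intro a ha
    rw [h2, selfConv, sum_indic_mul, Finset.sum_eq_zero, zero_sub]
    intro b hb
    rw [indic, if_neg]
    intro hb'
    apply hx
    have := Finset.add_mem_add (Finset.add_mem_add ha hb) hb'
    rwa [show a + b + (x - a - b) = x by abel] at this
  have h4 : A.card * c ^ p ≤ ∑ y, selfConv f y ^ p := by
    rw [← Equiv.sum_comp (Equiv.subLeft x)]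
    calc A.card * c ^ p = ∑ a ∈ A, selfConv f (x - a) ^ p := by
          rw [Finset.sum_congr rfl fun a ha => by rw [h3 a ha, hp.neg_pow]]
          simp
      _ ≤ _ := Finset.sum_le_sum_of_subset_of_nonneg (Finset.subset_univ A)
          fun y _ _ => hp.pow_nonneg _
  have h5 := h4.trans (sum_selfConv_pow_le f p)
  simp_rw [h1]
  refine le_trans ?_ (le_sum_const_add_pow _ (sum_autocorr_pow_nonneg f) hc0 p)
  calc 4 ^ p * c ^ (4 * p) * A.card = 4 ^ p * c ^ (3 * p) * (A.card * c ^ p) := by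
        rw [show 4 * p = 3 * p + p by ring, pow_add c]; ring
    _ ≤ _ := by gcongr

end Indicators

section Sifting

variable {V : Type*} [AddCommGroup V] [Fintype V] [DecidableEq V]

/-- The intersection of the translates `A - s i`. -/
def sift (A : Finset V) {m : ℕ} (s : Fin m → V) : Finset V :=
  Finset.univ.filter fun x => ∀ i, x + s i ∈ A

theorem indic_sift (A : Finset V) {m : ℕ} (s : Fin m → V) (x : V) :
    indic (sift A s) x = ∏ i, indic A (x + s i) := by
  unfold indic sift
  rw [Finset.prod_ite_zero]
  simp

theorem sum_sift (A : Finset V) (m : ℕ) (w : V → ℝ) :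
    ∑ s : Fin m → V, ∑ a ∈ sift A s, ∑ b ∈ sift A s, w (b - a) =
      Fintype.card V * ∑ x, w x * autocorr (indic A) x ^ m := by
  have h1 : ∀ s : Fin m → V, ∑ a ∈ sift A s, ∑ b ∈ sift A s, w (b - a) =
      ∑ a, ∑ x, w x * ∏ i, (indic A (a + s i) * indic A (a + x + s i)) := by
    intro s
    rw [← sum_indic_mul]
    refine Finset.sum_congr rfl fun a _ => ?_
    rw [← sum_indic_mul, Finset.mul_sum, ← Equiv.sum_comp (Equiv.addLeft a)]
    refine Finset.sum_congr rfl fun x _ => ?_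
    simp only [Equiv.coe_addLeft, indic_sift, Finset.prod_mul_distrib, add_sub_cancel_left]
    ring
  have h2 : ∀ a x : V, ∑ s : Fin m → V, ∏ i, (indic A (a + s i) * indic A (a + x + s i)) =
      autocorr (indic A) x ^ m := by
    intro a x
    rw [← Fintype.sum_pow (fun y => indic A (a + y) * indic A (a + x + y)), autocorr]
    rw [← Equiv.sum_comp (Equiv.addLeft a) (fun y => indic A y * indic A (y + x))]
    congr 1
    refine Finset.sum_congr rfl fun y _ => ?_
    simp only [Equiv.coe_addLeft]
    rw [add_right_comm]
  calc _ = ∑ s : Fin m → V, ∑ a, ∑ x, w x * ∏ i, (indic A (a + s i) * indic A (a + x + s i)) :=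
        Finset.sum_congr rfl fun s _ => h1 s
    _ = ∑ a : V, ∑ x, ∑ s : Fin m → V, w x * ∏ i, (indic A (a + s i) * indic A (a + x + s i)) := by
        rw [Finset.sum_comm]
        exact Finset.sum_congr rfl fun a _ => Finset.sum_comm
    _ = ∑ a : V, ∑ x, w x * autocorr (indic A) x ^ m := by
        simp_rw [← Finset.mul_sum, h2]
    _ = _ := by simp

/-- Dependent random choice: a large moment of the autocorrelation of `A` yields a fairly dense
set `B` nearly all of whose differences are popular differences of `A`. -/
theorem exists_dense_popular (A : Finset V) (hA : A.Nonempty) {p : ℕ}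
    (hp : 1 + 64 * ((9 / 8 : ℝ) ^ 4) ^ p ≤ 2 ^ p)
    (hm : 2 ^ p * ((A.card : ℝ) ^ 2 / Fintype.card V) ^ (4 * p) * Fintype.card V ≤
      ∑ y, autocorr (indic A) y ^ (4 * p)) (S : Finset V)
    (hS : ∀ x, x ∈ S ↔ 9 / 8 * ((A.card : ℝ) ^ 2 / Fintype.card V) ≤ autocorr (indic A) x) :
    ∃ B : Finset V, ((A.card : ℝ) / Fintype.card V) ^ (4 * p) * Fintype.card V ≤ B.card ∧
      (1 - 1 / 64) * (B.card : ℝ) ^ 2 ≤ ∑ a ∈ B, ∑ b ∈ B, indic S (b - a) := by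
  have hN : (0 : ℝ) < Fintype.card V := by exact_mod_cast Fintype.card_pos
  have hA0 : (0 : ℝ) < A.card := by exact_mod_cast hA.card_pos
  set N : ℝ := (Fintype.card V : ℝ) with hNdef
  set c : ℝ := (A.card : ℝ) ^ 2 / N with hc
  have hc0 : 0 < c := by positivity
  set r := autocorr (indic A) with hr
  have hr0 : ∀ x, 0 ≤ r x := fun x => Finset.sum_nonneg fun y _ =>
    mul_nonneg (indic_nonneg _ _) (indic_nonneg _ _)
  set w : V → ℝ := fun x => 1 - 64 * (1 - indic S x) with hw
  have h1 : N ^ 2 * c ^ (4 * p) ≤ N * ∑ x, w x * r x ^ (4 * p) := by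
    have h2 : ∀ x, r x ^ (4 * p) - 64 * (9 / 8 * c) ^ (4 * p) ≤ w x * r x ^ (4 * p) := by
      intro x
      by_cases hx : x ∈ S
      · simp only [hw, indic, if_pos hx]
        have : 0 ≤ (9 / 8 * c) ^ (4 * p) := by positivity
        linarith
      · simp only [hw, indic, if_neg hx]
        have h3 : r x ^ (4 * p) ≤ (9 / 8 * c) ^ (4 * p) := by
          have := hr0 x
          have h4 := mt (hS x).2 hx
          gcongr
          exact (not_le.1 h4).le
        linarith
    have h3 := Finset.sum_le_sum fun x (_ : x ∈ Finset.univ) => h2 x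
    rw [Finset.sum_sub_distrib] at h3
    simp only [Finset.sum_const, Finset.card_univ, nsmul_eq_mul, ← hNdef] at h3
    have h4 : N * c ^ (4 * p) * (1 + 64 * ((9 / 8 : ℝ) ^ 4) ^ p) ≤ N * c ^ (4 * p) * 2 ^ p := by
      gcongr
    rw [mul_pow, pow_mul (9 / 8 : ℝ)] at h3
    have h5 : N * c ^ (4 * p) ≤ ∑ x, w x * r x ^ (4 * p) := by linarith
    calc N ^ 2 * c ^ (4 * p) = N * (N * c ^ (4 * p)) := by ring
      _ ≤ _ := by gcongr
  rw [← sum_sift] at h1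
  have h2 : ∑ _s : Fin (4 * p) → V, N ^ 2 * c ^ (4 * p) / N ^ (4 * p) = N ^ 2 * c ^ (4 * p) := by
    simp only [Finset.sum_const, Finset.card_univ, Fintype.card_fun, Fintype.card_fin,
      nsmul_eq_mul, Nat.cast_pow, ← hNdef]
    field_simp
  rw [← h2] at h1
  obtain ⟨s, -, hs⟩ := Finset.exists_le_of_sum_le Finset.univ_nonempty h1
  set B := sift A s with hB
  have h3 : ∑ a ∈ B, ∑ b ∈ B, w (b - a) =
      (B.card : ℝ) ^ 2 - 64 * ((B.card : ℝ) ^ 2 - ∑ a ∈ B, ∑ b ∈ B, indic S (b - a)) := by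
    simp only [hw, Finset.sum_sub_distrib, ← Finset.mul_sum, Finset.sum_const, nsmul_eq_mul]
    ring
  have h4 : ∑ a ∈ B, ∑ b ∈ B, indic S (b - a) ≤ (B.card : ℝ) ^ 2 := by
    calc ∑ a ∈ B, ∑ b ∈ B, indic S (b - a) ≤ ∑ a ∈ B, ∑ b ∈ B, (1 : ℝ) :=
          Finset.sum_le_sum fun a _ => Finset.sum_le_sum fun b _ => indic_le_one _ _
      _ = _ := by simp [sq]
  have h5 : N ^ 2 * c ^ (4 * p) / N ^ (4 * p) = ((A.card / N) ^ (4 * p) * N) ^ 2 := by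
    rw [show c = (A.card / N) ^ 2 * N by rw [hc]; field_simp, mul_pow]
    generalize (A.card : ℝ) / N = t
    field_simp
    ring
  rw [h3] at hs
  refine ⟨B, ?_, ?_⟩
  · refine le_of_sq_le_sq ?_ (by positivity)
    rw [← h5]
    linarith
  · have : 0 ≤ N ^ 2 * c ^ (4 * p) / N ^ (4 * p) := by positivity
    linarith

end Sifting

section Concentration

/-- Hoeffding's lemma for the uniform measure on a finite set. -/
theorem sum_exp_le_of_sum_eq_zero {ι : Type*} (s : Finset ι) (φ : ι → ℝ)
    (h0 : ∑ i ∈ s, φ i = 0) (h1 : ∀ i ∈ s, |φ i| ≤ 1) (t : ℝ) :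
    ∑ i ∈ s, Real.exp (t * φ i) ≤ s.card * Real.exp (t ^ 2 / 2) := by
  calc ∑ i ∈ s, Real.exp (t * φ i) ≤ ∑ i ∈ s, (Real.cosh t + φ i * Real.sinh t) :=
        Finset.sum_le_sum fun i hi => by
          rw [mul_comm]; exact Real.exp_mul_le_cosh_add_mul_sinh (h1 i hi) t
    _ = s.card * Real.cosh t := by
        rw [Finset.sum_add_distrib, ← Finset.sum_mul, h0]; simp
    _ ≤ _ := by gcongr; exact Real.cosh_le_exp_half_sq t

theorem exp_average_le {ι : Type*} (s : Finset ι) (hs : s.Nonempty) (g : ι → ℝ) :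
    s.card * Real.exp ((∑ i ∈ s, g i) / s.card) ≤ ∑ i ∈ s, Real.exp (g i) := by
  have h0 : (0 : ℝ) < s.card := by exact_mod_cast hs.card_pos
  have h := convexOn_exp.map_sum_le (t := s) (w := fun _ => (s.card : ℝ)⁻¹) (p := g)
    (fun _ _ => by positivity) (by simp [h0.ne']) (fun _ _ => Set.mem_univ _)
  simp only [smul_eq_mul, ← Finset.mul_sum] at h
  rw [div_eq_inv_mul]
  calc s.card * Real.exp ((s.card : ℝ)⁻¹ * ∑ i ∈ s, g i)
      ≤ s.card * ((s.card : ℝ)⁻¹ * ∑ i ∈ s, Real.exp (g i)) := by gcongr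
    _ = _ := by field_simp

theorem average_le_log {ι : Type*} [Fintype ι] (s : Finset ι) (hs : s.Nonempty) (g : ι → ℝ) :
    (∑ i ∈ s, g i) / s.card ≤ Real.log ((∑ i, Real.exp (g i)) / s.card) := by
  have h0 : (0 : ℝ) < s.card := by exact_mod_cast hs.card_pos
  have h1 : ∑ i ∈ s, Real.exp (g i) ≤ ∑ i, Real.exp (g i) :=
    Finset.sum_le_sum_of_subset_of_nonneg (Finset.subset_univ s) fun i _ _ => (Real.exp_pos _).le
  have h2 := (exp_average_le s hs g).trans h1
  rw [Real.le_log_iff_exp_le (by refine div_pos (lt_of_lt_of_le ?_ h2) h0; positivity),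
    le_div_iff₀ h0]
  linarith

end Concentration

section AlmostPeriodicity

variable {V : Type*} [AddCommGroup V]

/-- The deviation of the sum over a sample `a` of a function from its expected value. -/
noncomputable def sampleDev (B : Finset V) (f : V → ℝ) {k : ℕ} (a : Fin k → V) (x : V) : ℝ :=
  ∑ i, (f (a i + x) - (∑ b ∈ B, f (b + x)) / B.card)

theorem sampleDev_add (B : Finset V) (f : V → ℝ) {k : ℕ} (a : Fin k → V) (t x : V) :
    sampleDev B f (fun i => a i + t) x =
      ∑ i, f (a i + (x + t)) - k * ((∑ b ∈ B, f (b + x)) / B.card) := by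
  simp [sampleDev, add_assoc, add_comm t x]

theorem sum_exp_sampleDev_le (B : Finset V) (hB : B.Nonempty) (f : V → ℝ)
    (hf0 : ∀ x, 0 ≤ f x) (hf1 : ∀ x, f x ≤ 1) (k : ℕ) (t : ℝ) (x : V) :
    ∑ a ∈ Fintype.piFinset fun _ : Fin k => B, Real.exp (t * sampleDev B f a x) ≤
      (B.card : ℝ) ^ k * Real.exp (t ^ 2 * k / 2) := by
  have h0 : (0 : ℝ) < B.card := by exact_mod_cast hB.card_pos
  set μ : ℝ := (∑ b ∈ B, f (b + x)) / B.card with hμ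
  have hμ0 : 0 ≤ μ := div_nonneg (Finset.sum_nonneg fun _ _ => hf0 _) h0.le
  have hμ1 : μ ≤ 1 := by
    rw [hμ, div_le_one h0]
    calc ∑ b ∈ B, f (b + x) ≤ ∑ b ∈ B, 1 := Finset.sum_le_sum fun _ _ => hf1 _
      _ = _ := by simp
  have h1 := sum_exp_le_of_sum_eq_zero B (fun b => f (b + x) - μ)
    (by rw [Finset.sum_sub_distrib, hμ]; simp; field_simp; simp)
    (fun b _ => abs_le.2 ⟨by linarith [hf0 (b + x)], by linarith [hf1 (b + x)]⟩) t
  calc ∑ a ∈ Fintype.piFinset fun _ : Fin k => B, Real.exp (t * sampleDev B f a x)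
      = ∑ a ∈ Fintype.piFinset fun _ : Fin k => B, ∏ i, Real.exp (t * (f (a i + x) - μ)) := by
        refine Finset.sum_congr rfl fun a _ => ?_
        rw [sampleDev, Finset.mul_sum, Real.exp_sum]
    _ = (∑ b ∈ B, Real.exp (t * (f (b + x) - μ))) ^ k := by
        rw [← Finset.prod_univ_sum (fun _ : Fin k => B)
          (fun _ b => Real.exp (t * (f (b + x) - μ)))]
        simp
    _ ≤ (B.card * Real.exp (t ^ 2 / 2)) ^ k :=
        pow_le_pow_left₀ (Finset.sum_nonneg fun _ _ => (Real.exp_pos _).le) h1 k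
    _ = _ := by
        rw [mul_pow, ← Real.exp_nat_mul]; congr 2; ring

variable [Fintype V]

/-- Most samples approximate the expected value at most points. -/
theorem exists_good_samples (B : Finset V) (hB : B.Nonempty) (f : V → ℝ)
    (hf0 : ∀ x, 0 ≤ f x) (hf1 : ∀ x, f x ≤ 1) (k : ℕ) (t : ℝ) :
    ∃ L : Finset (Fin k → V), (B.card : ℝ) ^ k / 2 ≤ L.card ∧ ∀ a ∈ L,
      ∑ x, Real.exp (t * |sampleDev B f a x|) ≤
        4 * Real.exp (t ^ 2 * k / 2) * Fintype.card V := by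
  classical
  set P : Finset (Fin k → V) := Fintype.piFinset fun _ : Fin k => B with hP
  set M : ℝ := Real.exp (t ^ 2 * k / 2) * Fintype.card V with hM
  have hV : (0 : ℝ) < Fintype.card V := by exact_mod_cast Fintype.card_pos
  have hM0 : 0 < M := by positivity
  have hPc : (P.card : ℝ) = (B.card : ℝ) ^ k := by simp [hP]
  have h1 : ∑ a ∈ P, ∑ x, Real.exp (t * |sampleDev B f a x|) ≤ 2 * M * P.card := by
    rw [Finset.sum_comm]
    calc ∑ x, ∑ a ∈ P, Real.exp (t * |sampleDev B f a x|)
        ≤ ∑ x, (∑ a ∈ P, Real.exp (t * sampleDev B f a x) +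
            ∑ a ∈ P, Real.exp (-t * sampleDev B f a x)) := by
          refine Finset.sum_le_sum fun x _ => ?_
          rw [← Finset.sum_add_distrib]
          refine Finset.sum_le_sum fun a _ => ?_
          rcases abs_choice (sampleDev B f a x) with h | h <;> rw [h]
          · linarith [Real.exp_pos (-t * sampleDev B f a x)]
          · rw [mul_neg, neg_mul]
            linarith [Real.exp_pos (t * sampleDev B f a x)]
      _ ≤ ∑ x : V, ((B.card : ℝ) ^ k * Real.exp (t ^ 2 * k / 2) +
            (B.card : ℝ) ^ k * Real.exp ((-t) ^ 2 * k / 2)) :=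
          Finset.sum_le_sum fun x _ => add_le_add (sum_exp_sampleDev_le B hB f hf0 hf1 k t x)
            (sum_exp_sampleDev_le B hB f hf0 hf1 k (-t) x)
      _ = _ := by simp [hM, hPc]; ring
  refine ⟨P.filter fun a => ∑ x, Real.exp (t * |sampleDev B f a x|) ≤ 4 * M, ?_, ?_⟩
  · have h2 : 4 * M * (P.filter fun a => ¬ ∑ x, Real.exp (t * |sampleDev B f a x|) ≤ 4 * M).card
        ≤ 2 * M * P.card := by
      refine le_trans ?_ h1
      refine le_trans ?_ (Finset.sum_le_sum_of_subset_of_nonneg (Finset.filter_subset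
        (fun a => ¬ ∑ x, Real.exp (t * |sampleDev B f a x|) ≤ 4 * M) P)
        fun a _ _ => Finset.sum_nonneg fun x _ => (Real.exp_pos _).le)
      rw [mul_comm, ← nsmul_eq_mul]
      refine Finset.card_nsmul_le_sum _ _ _ fun a ha => ?_
      exact (not_le.1 (Finset.mem_filter.1 ha).2).le
    have h3 := Finset.card_filter_add_card_filter_not (s := P)
      (fun a => ∑ x, Real.exp (t * |sampleDev B f a x|) ≤ 4 * M)
    have h4 : ((P.filter fun a => ∑ x, Real.exp (t * |sampleDev B f a x|) ≤ 4 * M).card : ℝ) +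
        (P.filter fun a => ¬ ∑ x, Real.exp (t * |sampleDev B f a x|) ≤ 4 * M).card = P.card := by
      exact_mod_cast h3
    rw [← hPc]
    have h5 : 2 * M * (2 * (P.filter fun a =>
        ¬ ∑ x, Real.exp (t * |sampleDev B f a x|) ≤ 4 * M).card) ≤ 2 * M * P.card := by linarith
    have h6 := le_of_mul_le_mul_left h5 (by positivity)
    linarith
  · intro a ha
    rw [mul_assoc]
    exact (Finset.mem_filter.1 ha).2

variable [DecidableEq V]

theorem exists_many_diagonal_translates (k : ℕ) (L : Finset (Fin k → V)) :
    ∃ (z : Fin k → V) (T : Finset V), (∀ t ∈ T, (fun i => z i + t) ∈ L) ∧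
      (L.card : ℝ) * Fintype.card V / (Fintype.card V : ℝ) ^ k ≤ T.card := by
  have hV : (0 : ℝ) < Fintype.card V := by exact_mod_cast Fintype.card_pos
  have h1 : ∑ z : Fin k → V, ((Finset.univ.filter fun t : V => (fun i => z i + t) ∈ L).card : ℝ) =
      L.card * Fintype.card V := by
    have h2 : ∀ z : Fin k → V,
        ((Finset.univ.filter fun t : V => (fun i => z i + t) ∈ L).card : ℝ) =
        ∑ t : V, if (fun i => z i + t) ∈ L then (1 : ℝ) else 0 := fun z => by simp
    simp_rw [h2]
    rw [Finset.sum_comm]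
    have h3 : ∀ t : V, ∑ z : Fin k → V, (if (fun i => z i + t) ∈ L then (1 : ℝ) else 0) =
        L.card := by
      intro t
      have := Equiv.sum_comp (Equiv.addRight (fun _ : Fin k => t))
        (fun z => if z ∈ L then (1 : ℝ) else 0)
      rw [show (L.card : ℝ) = ∑ z, if z ∈ L then (1 : ℝ) else 0 by simp, ← this]
      rfl
    simp_rw [h3]
    simp [mul_comm]
  have h2 : ∑ _z : Fin k → V, (L.card : ℝ) * Fintype.card V / (Fintype.card V : ℝ) ^ k ≤
      ∑ z : Fin k → V, ((Finset.univ.filter fun t : V => (fun i => z i + t) ∈ L).card : ℝ) := by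
    rw [h1]
    simp only [Finset.sum_const, Finset.card_univ, Fintype.card_fun, Fintype.card_fin,
      nsmul_eq_mul, Nat.cast_pow]
    refine le_of_eq ?_
    field_simp
  obtain ⟨z, -, hz⟩ := Finset.exists_le_of_sum_le Finset.univ_nonempty h2
  exact ⟨z, _, fun t ht => (Finset.mem_filter.1 ht).2, hz⟩

/-- The average of `f` over the translate by `y` of the differences of elements of `B`. -/
noncomputable def diffAvg (B : Finset V) (f : V → ℝ) (y : V) : ℝ :=
  (∑ a ∈ B, ∑ b ∈ B, f (y + (b - a))) / (B.card : ℝ) ^ 2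

/-- Croot–Sisask almost periodicity, in the sup norm, for averages over `B - B`. -/
theorem exists_almost_periods (B : Finset V) (hB : B.Nonempty) (f : V → ℝ)
    (hf0 : ∀ x, 0 ≤ f x) (hf1 : ∀ x, f x ≤ 1) {ε : ℝ} (hε : 0 < ε) (k : ℕ) (hk0 : 0 < k)
    (hk : 2 * Real.log (4 * (Fintype.card V / B.card)) ≤ ε ^ 2 * k) :
    ∃ T : Finset V, ((B.card : ℝ) / Fintype.card V) ^ k / 2 * Fintype.card V ≤ T.card ∧
      ∀ t ∈ T, ∀ t' ∈ T, ∀ y,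
        |diffAvg B f (y + (t - t')) - diffAvg B f y| ≤ 2 * ε := by
  have hV : (0 : ℝ) < Fintype.card V := by exact_mod_cast Fintype.card_pos
  have hB0 : (0 : ℝ) < B.card := by exact_mod_cast hB.card_pos
  have hk0' : (0 : ℝ) < k := by exact_mod_cast hk0
  obtain ⟨L, hL, hgood⟩ := exists_good_samples B hB f hf0 hf1 k ε
  obtain ⟨z, T, hT, hTc⟩ := exists_many_diagonal_translates k L
  refine ⟨T, ?_, ?_⟩
  · refine le_trans ?_ hTc
    rw [div_pow]
    calc (B.card : ℝ) ^ k / (Fintype.card V : ℝ) ^ k / 2 * Fintype.card V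
        = (B.card : ℝ) ^ k / 2 * Fintype.card V / (Fintype.card V : ℝ) ^ k := by ring
      _ ≤ _ := by gcongr
  set F : V → ℝ := fun x => (∑ b ∈ B, f (b + x)) / B.card with hF
  set G : V → ℝ := fun y => (∑ a ∈ B, (∑ i, f (z i + (y - a))) / k) / B.card with hG
  have hdiff : ∀ y, diffAvg B f y = (∑ a ∈ B, F (y - a)) / B.card := by
    intro y
    simp only [diffAvg, hF, ← Finset.sum_div]
    rw [div_div, sq]
    congr 1
    refine Finset.sum_congr rfl fun a _ => Finset.sum_congr rfl fun b _ => ?_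
    congr 1
    abel
  have key : ∀ t ∈ T, ∀ y, |G (y + t) - diffAvg B f y| ≤ ε := by
    intro t ht y
    have h1 := hgood _ (hT t ht)
    set D : V → ℝ := sampleDev B f (fun i => z i + t) with hD
    have hDF : ∀ x, D x = k * ((∑ i, f (z i + (x + t))) / k - F x) := by
      intro x
      rw [hD, sampleDev_add, mul_sub, mul_div_cancel₀ _ hk0'.ne']
    have h2 : (∑ a ∈ B, ε * |D (y - a)|) / B.card ≤ ε * (ε * k) := by
      refine (average_le_log B hB fun a => ε * |D (y - a)|).trans ?_
      have h3 : ∑ a, Real.exp (ε * |D (y - a)|) = ∑ a, Real.exp (ε * |D a|) :=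
        Equiv.sum_comp (Equiv.subLeft y) fun a => Real.exp (ε * |D a|)
      have h4 : (∑ a, Real.exp (ε * |D (y - a)|)) / B.card ≤
          4 * (Fintype.card V / B.card) * Real.exp (ε ^ 2 * k / 2) := by
        rw [h3]
        calc (∑ a, Real.exp (ε * |D a|)) / B.card
            ≤ (4 * Real.exp (ε ^ 2 * k / 2) * Fintype.card V) / B.card := by gcongr
          _ = _ := by ring
      have h5 : 0 < (∑ a, Real.exp (ε * |D (y - a)|)) / B.card :=
        div_pos (Finset.sum_pos (fun _ _ => Real.exp_pos _) Finset.univ_nonempty) hB0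
      refine (Real.log_le_log h5 h4).trans ?_
      rw [Real.log_mul (by positivity) (by positivity), Real.log_exp]
      linarith
    rw [← Finset.mul_sum, mul_div_assoc] at h2
    have h6 := le_of_mul_le_mul_left h2 hε
    have h7 : G (y + t) - diffAvg B f y = (∑ a ∈ B, D (y - a)) / B.card / k := by
      rw [hdiff]
      simp only [hG, hDF, ← Finset.mul_sum, Finset.sum_sub_distrib]
      field_simp
      congr 1
      refine Finset.sum_congr rfl fun a _ => ?_
      rw [show y + t - a = y - a + t by abel]
    rw [h7, abs_div, abs_div, Nat.abs_cast, Nat.abs_cast, div_le_iff₀ hk0']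
    refine le_trans ?_ h6
    gcongr
    exact Finset.abs_sum_le_sum_abs _ _
  intro t ht t' ht' y
  have h1 := abs_le.1 (key t' ht' (y + (t - t')))
  have h2 := abs_le.1 (key t ht y)
  rw [show y + (t - t') + t' = y + t by abel] at h1
  rw [abs_le]
  constructor <;> linarith [h1.1, h1.2, h2.1, h2.2]

end AlmostPeriodicity

section Chang

variable {F : Type*} [Field F] {V : Type*} [AddCommGroup V] [Module F V]

theorem LinearMap.pi_surjective_of_linearIndependent {ι : Type*} [Fintype ι]
    {ℓ : ι → Module.Dual F V} (hℓ : LinearIndependent F ℓ) :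
    Function.Surjective (LinearMap.pi ℓ) := by
  classical
  rw [← LinearMap.range_eq_top]
  by_contra h
  obtain ⟨g, hg0, hg⟩ := Submodule.exists_le_ker_of_lt_top _ (lt_top_iff_ne_top.2 h)
  apply hg0
  have h1 : ∀ y : ι → F, g y = ∑ i, y i * g (Pi.single i 1) := fun y => by
    rw [LinearMap.pi_apply_eq_sum_univ g y]
    refine Finset.sum_congr rfl fun i _ => ?_
    rw [smul_eq_mul]
    congr 2
    ext j
    simp [Pi.single_apply, eq_comm]
  have h2 : ∑ i, g (Pi.single i 1) • ℓ i = 0 := by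
    ext x
    have h3 : g (LinearMap.pi ℓ x) = 0 := hg (LinearMap.mem_range_self _ x)
    rw [h1] at h3
    simpa [mul_comm] using h3
  have h4 := Fintype.linearIndependent_iff.1 hℓ _ h2
  ext i
  simpa using h4 i

variable [Fintype F] [Fintype V]

/-- Linearly independent functionals are independent random variables. -/
theorem sum_prod_comp_of_linearIndependent {ι : Type*} [Fintype ι]
    {ℓ : ι → Module.Dual F V} (hℓ : LinearIndependent F ℓ) (h : ι → F → ℝ) :
    (Fintype.card F : ℝ) ^ Fintype.card ι * ∑ x, ∏ i, h i (ℓ i x) =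
      Fintype.card V * ∏ i, ∑ c, h i c := by
  classical
  have hs := LinearMap.pi_surjective_of_linearIndependent hℓ
  have h1 : ∀ y : ι → F, ∑ x, ∏ i, h i (ℓ i x + y i) = ∑ x, ∏ i, h i (ℓ i x) := by
    intro y
    obtain ⟨v, rfl⟩ := hs y
    rw [← Equiv.sum_comp (Equiv.addRight v) fun x => ∏ i, h i (ℓ i x)]
    simp
  calc (Fintype.card F : ℝ) ^ Fintype.card ι * ∑ x, ∏ i, h i (ℓ i x)
      = ∑ y : ι → F, ∑ x, ∏ i, h i (ℓ i x + y i) := by simp [h1]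
    _ = ∑ x, ∑ y : ι → F, ∏ i, h i (ℓ i x + y i) := Finset.sum_comm
    _ = ∑ _x : V, ∑ y : ι → F, ∏ i, h i (y i) := by
        refine Finset.sum_congr rfl fun x _ => ?_
        rw [← Equiv.sum_comp (Equiv.addLeft (fun i => ℓ i x)) fun y => ∏ i, h i (y i)]
        rfl
    _ = _ := by
        rw [Finset.prod_univ_sum]
        simp

variable (ψ : AddChar F ℂ)

/-- A Chang-type bound: linearly independent functionals whose characters are all biased on `T`
are few in number. -/
theorem card_le_of_linearIndependent_of_biased (hψ : ψ ≠ 1) {ι : Type*} [Fintype ι]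
    {ℓ : ι → Module.Dual F V} (hℓ : LinearIndependent F ℓ) (T : Finset V) (hT : T.Nonempty)
    (hb : ∀ i, (T.card : ℝ) / 2 ≤ ‖∑ t ∈ T, ψ (ℓ i t)‖) :
    (Fintype.card ι : ℝ) ≤ 8 * Real.log (Fintype.card V / T.card) := by
  classical
  have hT0 : (0 : ℝ) < T.card := by exact_mod_cast hT.card_pos
  have hV : (0 : ℝ) < Fintype.card V := by exact_mod_cast Fintype.card_pos
  have hF : (0 : ℝ) < Fintype.card F := by exact_mod_cast Fintype.card_pos
  have hc : ∀ i, ∃ c : ℂ, ‖c‖ = 1 ∧ c * ∑ t ∈ T, ψ (ℓ i t) = ‖∑ t ∈ T, ψ (ℓ i t)‖ := by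
    intro i
    have h0 : ‖∑ t ∈ T, ψ (ℓ i t)‖ ≠ 0 := (lt_of_lt_of_le (by positivity) (hb i)).ne'
    have h0' : ((‖∑ t ∈ T, ψ (ℓ i t)‖ : ℝ) : ℂ) ≠ 0 := by exact_mod_cast h0
    refine ⟨(starRingEnd ℂ) (∑ t ∈ T, ψ (ℓ i t)) / ‖∑ t ∈ T, ψ (ℓ i t)‖, ?_, ?_⟩
    · rw [norm_div, RCLike.norm_conj, Complex.norm_real, norm_norm, div_self h0]
    · rw [div_mul_eq_mul_div, Complex.conj_mul', sq, mul_div_assoc, div_self h0', mul_one]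
  choose c hc1 hc2 using hc
  set φ : ι → F → ℝ := fun i a => (c i * ψ a).re with hφ
  have hφ0 : ∀ i, ∑ a, φ i a = 0 := by
    intro i
    simp only [hφ]
    rw [← Complex.re_sum, ← Finset.mul_sum, AddChar.sum_eq_zero_of_ne_one hψ]
    simp
  have hφ1 : ∀ i a, |φ i a| ≤ 1 := by
    intro i a
    refine (Complex.abs_re_le_norm _).trans ?_
    rw [norm_mul, hc1, AddChar.norm_apply, one_mul]
  have h1 : ∑ x, Real.exp (∑ i, 1 / 2 * φ i (ℓ i x)) ≤
      Fintype.card V * Real.exp (Fintype.card ι / 8) := by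
    have h2 := sum_prod_comp_of_linearIndependent hℓ fun i a => Real.exp (1 / 2 * φ i a)
    simp_rw [← Real.exp_sum] at h2
    have h3 : ∏ i, ∑ a, Real.exp (1 / 2 * φ i a) ≤
        (Fintype.card F * Real.exp (1 / 8)) ^ Fintype.card ι := by
      rw [← Finset.card_univ (α := ι), ← Finset.prod_const]
      refine Finset.prod_le_prod (fun i _ => Finset.sum_nonneg fun a _ => (Real.exp_pos _).le)
        fun i _ => ?_
      have := sum_exp_le_of_sum_eq_zero Finset.univ (φ i) (hφ0 i) (fun a _ => hφ1 i a) (1 / 2)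
      norm_num at this ⊢
      exact this
    rw [mul_pow, ← Real.exp_nat_mul] at h3
    have hq : (0 : ℝ) < (Fintype.card F : ℝ) ^ Fintype.card ι := by positivity
    refine le_of_mul_le_mul_left ?_ hq
    rw [h2]
    calc _ ≤ (Fintype.card V : ℝ) * ((Fintype.card F : ℝ) ^ Fintype.card ι *
            Real.exp (Fintype.card ι * (1 / 8))) := by gcongr
      _ = _ := by rw [mul_one_div]; ring
  have h2 := average_le_log T hT fun x => ∑ i, 1 / 2 * φ i (ℓ i x)
  have h3 : (Fintype.card ι : ℝ) / 4 ≤ (∑ x ∈ T, ∑ i, 1 / 2 * φ i (ℓ i x)) / T.card := by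
    rw [le_div_iff₀ hT0, Finset.sum_comm]
    have h4 : ∀ i, (T.card : ℝ) / 4 ≤ ∑ x ∈ T, 1 / 2 * φ i (ℓ i x) := by
      intro i
      have h5 : ∑ x ∈ T, φ i (ℓ i x) = ‖∑ t ∈ T, ψ (ℓ i t)‖ := by
        simp only [hφ]
        rw [← Complex.re_sum, ← Finset.mul_sum, hc2, Complex.ofReal_re]
      rw [← Finset.mul_sum, h5]
      linarith [hb i]
    calc (Fintype.card ι : ℝ) / 4 * T.card = ∑ _i : ι, (T.card : ℝ) / 4 := by simp; ring
      _ ≤ _ := Finset.sum_le_sum fun i _ => h4 i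
  have h4 : Real.log ((∑ x, Real.exp (∑ i, 1 / 2 * φ i (ℓ i x))) / T.card) ≤
      Real.log (Fintype.card V / T.card) + Fintype.card ι / 8 := by
    have h5 : 0 < (∑ x, Real.exp (∑ i, 1 / 2 * φ i (ℓ i x))) / T.card :=
      div_pos (Finset.sum_pos (fun _ _ => Real.exp_pos _) Finset.univ_nonempty) hT0
    rw [← Real.log_exp ((Fintype.card ι : ℝ) / 8), ← Real.log_mul (by positivity) (by positivity)]
    refine Real.log_le_log h5 ?_
    rw [div_mul_eq_mul_div]
    gcongr
  linarith

end Chang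

section Fourier

variable {F : Type*} [Field F] {V : Type*} [AddCommGroup V] [Module F V] (ψ : AddChar F ℂ)

theorem sum_dual_char_eq_zero [Fintype (Module.Dual F V)] (hψ : ψ ≠ 1) {x : V} (hx : x ≠ 0) :
    ∑ ℓ : Module.Dual F V, ψ (ℓ x) = 0 := by
  let χ : AddChar (Module.Dual F V) ℂ :=
    { toFun := fun ℓ => ψ (ℓ x)
      map_zero_eq_one' := by simp
      map_add_eq_mul' := fun a b => by simp [AddChar.map_add_eq_mul] }
  have h : χ ≠ 1 := by
    rw [AddChar.ne_one_iff] at hψ ⊢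
    obtain ⟨a, ha⟩ := hψ
    obtain ⟨ℓ, hℓ⟩ : ∃ ℓ : Module.Dual F V, ℓ x ≠ 0 := by
      by_contra! h
      exact hx ((Module.forall_dual_apply_eq_zero_iff F x).1 h)
    refine ⟨(a / ℓ x) • ℓ, ?_⟩
    simpa [χ, hℓ] using ha
  exact AddChar.sum_eq_zero_of_ne_one h

variable [Fintype F]

/-- The normalised character sum of `ℓ` over the set `T`. -/
noncomputable def bias (T : Finset V) (ℓ : Module.Dual F V) : ℂ :=
  (∑ t ∈ T, ψ (ℓ t)) / T.card

theorem norm_bias_sq (T : Finset V) (ℓ : Module.Dual F V) :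
    ((‖bias ψ T ℓ‖ ^ 2 : ℝ) : ℂ) = (∑ a ∈ T, ∑ b ∈ T, ψ (ℓ (b - a))) / (T.card : ℂ) ^ 2 := by
  rw [Complex.ofReal_pow, ← Complex.conj_mul', bias, map_div₀, map_sum, map_natCast,
    div_mul_div_comm, Finset.sum_mul_sum, ← sq]
  congr 1
  refine Finset.sum_congr rfl fun a _ => Finset.sum_congr rfl fun b _ => ?_
  rw [sub_eq_neg_add, map_add, AddChar.map_add_eq_mul, map_neg, AddChar.map_neg_eq_conj]

theorem diffAvg_expansion [Fintype (Module.Dual F V)] (T : Finset V) {f : V → ℝ}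
    {g : Module.Dual F V → ℂ} (hf : ∀ y, (f y : ℂ) = ∑ ℓ, g ℓ * ψ (ℓ y)) (y : V) :
    (diffAvg T f y : ℂ) = ∑ ℓ, g ℓ * (‖bias ψ T ℓ‖ ^ 2 : ℝ) * ψ (ℓ y) := by
  have h : ∀ ℓ, g ℓ * (‖bias ψ T ℓ‖ ^ 2 : ℝ) * ψ (ℓ y) =
      (∑ a ∈ T, ∑ b ∈ T, g ℓ * ψ (ℓ (y + (b - a)))) / (T.card : ℂ) ^ 2 := by
    intro ℓ
    rw [norm_bias_sq, mul_div_assoc', div_mul_eq_mul_div, Finset.mul_sum, Finset.sum_mul]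
    congr 1
    refine Finset.sum_congr rfl fun a _ => ?_
    rw [Finset.mul_sum, Finset.sum_mul]
    refine Finset.sum_congr rfl fun b _ => ?_
    rw [map_add, AddChar.map_add_eq_mul]
    ring
  simp_rw [h, diffAvg]
  push_cast
  simp_rw [hf, ← Finset.sum_div]
  congr 1
  symm
  rw [Finset.sum_comm]
  exact Finset.sum_congr rfl fun a _ => Finset.sum_comm

theorem iterate_diffAvg_expansion [Fintype (Module.Dual F V)] (T : Finset V) {f : V → ℝ}
    {g : Module.Dual F V → ℂ} (hf : ∀ y, (f y : ℂ) = ∑ ℓ, g ℓ * ψ (ℓ y)) (l : ℕ) (y : V) :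
    ((diffAvg T)^[l] f y : ℂ) = ∑ ℓ, g ℓ * ((‖bias ψ T ℓ‖ ^ 2) ^ l : ℝ) * ψ (ℓ y) := by
  induction l generalizing y with
  | zero => simpa using hf y
  | succ l ih =>
    rw [Function.iterate_succ_apply', diffAvg_expansion ψ T ih]
    refine Finset.sum_congr rfl fun ℓ _ => ?_
    rw [pow_succ _ l]
    push_cast
    ring

variable [Fintype V]

/-- The Fourier coefficient of `f` at the functional `ℓ`. -/
noncomputable def dualFourierCoeff (f : V → ℝ) (ℓ : Module.Dual F V) : ℂ :=
  (∑ x, f x * ψ (ℓ (-x))) / Fintype.card V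

theorem norm_dualFourierCoeff_le_one (f : V → ℝ) (hf0 : ∀ x, 0 ≤ f x) (hf1 : ∀ x, f x ≤ 1)
    (ℓ : Module.Dual F V) : ‖dualFourierCoeff ψ f ℓ‖ ≤ 1 := by
  have hV : (0 : ℝ) < Fintype.card V := by exact_mod_cast Fintype.card_pos
  rw [dualFourierCoeff, norm_div, Complex.norm_natCast, div_le_one hV]
  calc ‖∑ x, (f x : ℂ) * ψ (ℓ (-x))‖ ≤ ∑ x, ‖(f x : ℂ) * ψ (ℓ (-x))‖ := norm_sum_le _ _
    _ ≤ ∑ _x : V, 1 := by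
        refine Finset.sum_le_sum fun x _ => ?_
        rw [norm_mul, AddChar.norm_apply, mul_one, Complex.norm_real, Real.norm_eq_abs,
          abs_of_nonneg (hf0 x)]
        exact hf1 x
    _ = _ := by simp

variable [Fintype (Module.Dual F V)]

theorem card_dual_eq : Fintype.card (Module.Dual F V) = Fintype.card V := by
  rw [Module.card_eq_pow_finrank (K := F), Module.card_eq_pow_finrank (K := F) (V := V),
    Subspace.dual_finrank_eq]

theorem sum_dual_char [DecidableEq V] (hψ : ψ ≠ 1) (x : V) :
    ∑ ℓ : Module.Dual F V, ψ (ℓ x) = if x = 0 then (Fintype.card V : ℂ) else 0 := by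
  split_ifs with h
  · simp [h, card_dual_eq]
  · exact sum_dual_char_eq_zero ψ hψ h

theorem fourier_inversion (hψ : ψ ≠ 1) (f : V → ℝ) (y : V) :
    (f y : ℂ) = ∑ ℓ : Module.Dual F V, dualFourierCoeff ψ f ℓ * ψ (ℓ y) := by
  classical
  have hV : (Fintype.card V : ℂ) ≠ 0 := by exact_mod_cast Fintype.card_ne_zero
  have h1 : ∀ ℓ : Module.Dual F V, dualFourierCoeff ψ f ℓ * ψ (ℓ y) =
      ∑ x, f x / Fintype.card V * ψ (ℓ (y - x)) := by
    intro ℓ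
    rw [dualFourierCoeff, div_mul_eq_mul_div, Finset.sum_mul, Finset.sum_div]
    refine Finset.sum_congr rfl fun x _ => ?_
    rw [sub_eq_neg_add, map_add, AddChar.map_add_eq_mul]
    ring
  simp_rw [h1]
  rw [Finset.sum_comm]
  simp_rw [← Finset.mul_sum, sum_dual_char ψ hψ, sub_eq_zero]
  simp [hV]

theorem sum_norm_bias_sq (hψ : ψ ≠ 1) (T : Finset V) (hT : T.Nonempty) :
    ∑ ℓ : Module.Dual F V, ‖bias ψ T ℓ‖ ^ 2 = Fintype.card V / T.card := by
  classical
  have hT0 : (T.card : ℂ) ≠ 0 := by exact_mod_cast hT.card_pos.ne'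
  have h : ((∑ ℓ : Module.Dual F V, ‖bias ψ T ℓ‖ ^ 2 : ℝ) : ℂ) =
      ((Fintype.card V / T.card : ℝ) : ℂ) := by
    rw [Complex.ofReal_sum]
    simp_rw [norm_bias_sq, ← Finset.sum_div]
    rw [Finset.sum_comm]
    have h1 : ∀ a ∈ T, ∑ ℓ : Module.Dual F V, ∑ b ∈ T, ψ (ℓ (b - a)) = Fintype.card V := by
      intro a ha
      rw [Finset.sum_comm]
      simp_rw [sum_dual_char ψ hψ, sub_eq_zero]
      simp [ha]
    rw [Finset.sum_congr rfl h1]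
    push_cast
    simp only [Finset.sum_const, nsmul_eq_mul]
    field_simp
  exact_mod_cast h

end Fourier

section Bootstrap

variable {V : Type*} [AddCommGroup V]

theorem abs_diffAvg_sub_le (T : Finset V) (hT : T.Nonempty) (f : V → ℝ) (c δ : ℝ) (x : V)
    (h : ∀ t ∈ T, ∀ t' ∈ T, |f (x + (t - t')) - c| ≤ δ) : |diffAvg T f x - c| ≤ δ := by
  have hT0 : (0 : ℝ) < T.card := by exact_mod_cast hT.card_pos
  have h1 : diffAvg T f x - c = (∑ a ∈ T, ∑ b ∈ T, (f (x + (b - a)) - c)) / (T.card : ℝ) ^ 2 := by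
    simp only [diffAvg, Finset.sum_sub_distrib, Finset.sum_const, nsmul_eq_mul]
    field_simp
  rw [h1, abs_div, abs_of_pos (by positivity : (0 : ℝ) < (T.card : ℝ) ^ 2),
    div_le_iff₀ (by positivity)]
  calc |∑ a ∈ T, ∑ b ∈ T, (f (x + (b - a)) - c)|
      ≤ ∑ a ∈ T, ∑ b ∈ T, |f (x + (b - a)) - c| :=
        (Finset.abs_sum_le_sum_abs _ _).trans
          (Finset.sum_le_sum fun a _ => Finset.abs_sum_le_sum_abs _ _)
    _ ≤ ∑ a ∈ T, ∑ b ∈ T, δ :=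
        Finset.sum_le_sum fun a ha => Finset.sum_le_sum fun b hb => h b hb a ha
    _ = _ := by simp; ring

theorem abs_iterate_diffAvg_sub_le (T : Finset V) (hT : T.Nonempty) (f : V → ℝ) {δ : ℝ}
    (h : ∀ t ∈ T, ∀ t' ∈ T, ∀ x, |f (x + (t - t')) - f x| ≤ δ) (l : ℕ) (x : V) :
    |(diffAvg T)^[l] f x - f x| ≤ l * δ := by
  induction l generalizing x with
  | zero => simp
  | succ l ih =>
    rw [Function.iterate_succ_apply']
    refine abs_diffAvg_sub_le T hT _ _ _ _ fun t ht t' ht' => ?_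
    have h1 := ih (x + (t - t'))
    have h2 := h t ht t' ht' x
    calc _ = |((diffAvg T)^[l] f (x + (t - t')) - f (x + (t - t'))) +
          (f (x + (t - t')) - f x)| := by congr 1; ring
      _ ≤ _ := abs_add_le _ _
      _ ≤ _ := by push_cast; linarith

variable {F : Type*} [Field F] [Fintype F] [Module F V] [Fintype V]

/-- Averages over `B - B`, further smoothed by `T - T`, are nearly invariant under a subspace whose
codimension is controlled by the density of `T`. -/
theorem exists_subspace_smoothed (B T : Finset V) (hB : B.Nonempty) (hT : T.Nonempty) (f : V → ℝ)
    (hf0 : ∀ x, 0 ≤ f x) (hf1 : ∀ x, f x ≤ 1) (l : ℕ) :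
    ∃ W : Submodule F V,
      (Module.finrank F V : ℝ) ≤ Module.finrank F W + 8 * Real.log (Fintype.card V / T.card) ∧
      ∀ v ∈ W, |(diffAvg T)^[l] (diffAvg B f) v - (diffAvg T)^[l] (diffAvg B f) 0| ≤
        2 * (1 / 4) ^ l * (Fintype.card V / B.card) := by
  classical
  have : Finite (Module.Dual F V) := Module.finite_of_finite F
  have : Fintype (Module.Dual F V) := Fintype.ofFinite _
  obtain ⟨ψ, hψ⟩ : ∃ ψ : AddChar F ℂ, ψ ≠ 1 := by
    refine ⟨AddChar.FiniteField.primitiveChar_to_Complex F, fun h => ?_⟩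
    have := AddChar.FiniteField.primitiveChar_to_Complex_isPrimitive F one_ne_zero
    rw [h] at this
    exact this (by ext; simp)
  have hT0 : (0 : ℝ) < T.card := by exact_mod_cast hT.card_pos
  set Δ : Set (Module.Dual F V) := {ℓ | 1 / 2 ≤ ‖bias ψ T ℓ‖} with hΔ
  refine ⟨(Submodule.span F Δ).dualCoannihilator, ?_, ?_⟩
  · obtain ⟨ℓ, hℓ, -, hli⟩ := Submodule.exists_fun_fin_finrank_span_eq F Δ
    have h1 := card_le_of_linearIndependent_of_biased ψ hψ hli T hT fun i => by
      have h2 : 1 / 2 ≤ ‖bias ψ T (ℓ i)‖ := hℓ i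
      rw [bias, norm_div, Complex.norm_natCast, le_div_iff₀ hT0] at h2
      linarith
    rw [Fintype.card_fin] at h1
    have h2 := Subspace.finrank_add_finrank_dualCoannihilator_eq (Submodule.span F Δ)
    rw [← h2]
    push_cast
    linarith
  · intro v hv
    have hexp := iterate_diffAvg_expansion ψ T
      (diffAvg_expansion ψ B (fourier_inversion ψ hψ f)) l
    rw [← Real.norm_eq_abs, ← Complex.norm_real]
    push_cast
    rw [hexp, hexp, ← Finset.sum_sub_distrib, ← sum_norm_bias_sq ψ hψ B hB, Finset.mul_sum]
    refine (norm_sum_le _ _).trans (Finset.sum_le_sum fun ℓ _ => ?_)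
    rw [← mul_sub, norm_mul, norm_mul, norm_mul, Complex.norm_real, Complex.norm_real,
      Real.norm_of_nonneg (by positivity), Real.norm_of_nonneg (by positivity)]
    have hc := norm_dualFourierCoeff_le_one ψ f hf0 hf1 ℓ
    by_cases hℓ : ℓ ∈ Δ
    · have : ℓ v = 0 := (Submodule.mem_dualCoannihilator _).1 hv ℓ (Submodule.subset_span hℓ)
      simp only [this, map_zero, sub_self, norm_zero, mul_zero]
      positivity
    · have h1 : ‖bias ψ T ℓ‖ ≤ 1 / 2 := (not_le.1 hℓ).le
      have h2 : ‖bias ψ T ℓ‖ ^ 2 ≤ 1 / 4 := by nlinarith [norm_nonneg (bias ψ T ℓ)]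
      have h3 : ‖ψ (ℓ v) - ψ (ℓ 0)‖ ≤ 2 := by
        refine (norm_sub_le _ _).trans ?_
        rw [AddChar.norm_apply, AddChar.norm_apply]; norm_num
      calc _ ≤ 1 * ‖bias ψ B ℓ‖ ^ 2 * (1 / 4) ^ l * 2 := by gcongr
        _ = _ := by ring

end Bootstrap

section Increment

variable {F : Type*} [Field F] [Fintype F] {V : Type*} [AddCommGroup V] [Module F V] [Fintype V]
  [DecidableEq V]

/-- Averages over `B - B` hardly decrease when translated by vectors of a suitable large
subspace. -/
theorem exists_subspace_popular (B : Finset V) (f : V → ℝ) (hB : B.Nonempty)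
    (hf0 : ∀ x, 0 ≤ f x) (hf1 : ∀ x, f x ≤ 1) (L : ℕ)
    (hL : (Fintype.card V : ℝ) ≤ 2 ^ L * B.card) :
    ∃ W : Submodule F V,
      Module.finrank F V ≤ Module.finrank F W + 2 ^ 20 * (L + 4) ^ 4 ∧
      ∀ v ∈ W, diffAvg B f 0 - 1 / 32 ≤ diffAvg B f v := by
  have hV : (0 : ℝ) < Fintype.card V := by exact_mod_cast Fintype.card_pos
  have hB0 : (0 : ℝ) < B.card := by exact_mod_cast hB.card_pos
  have hl2 : Real.log 2 ≤ 1 := by linarith [Real.log_two_lt_d9]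
  set l : ℕ := L + 4 with hl
  have hlr : (l : ℝ) = L + 4 := by rw [hl]; push_cast; ring
  have hlpos : (0 : ℝ) < l := by rw [hlr]; positivity
  obtain ⟨k, hk⟩ : ∃ k : ℕ, k = 2 ^ 17 * l ^ 3 := ⟨_, rfl⟩
  have hkr : (k : ℝ) = 2 ^ 17 * (l : ℝ) ^ 3 := by rw [hk]; push_cast; ring
  have hk1 : 1 ≤ k := by rw [hk]; exact Nat.one_le_iff_ne_zero.2 (by positivity)
  have hk1r : (1 : ℝ) ≤ k := by exact_mod_cast hk1
  set ε : ℝ := 1 / (256 * l) with hε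
  have hratio : (Fintype.card V : ℝ) / B.card ≤ 2 ^ L := (div_le_iff₀ hB0).2 hL
  have hlog : 2 * Real.log (4 * (Fintype.card V / B.card)) ≤ ε ^ 2 * k := by
    have h1 : Real.log (4 * (Fintype.card V / B.card)) ≤ Real.log (2 ^ (L + 2)) := by
      refine Real.log_le_log (by positivity) ?_
      rw [pow_add]; linarith
    rw [Real.log_pow] at h1
    push_cast at h1
    have h2 : ((L : ℝ) + 2) * Real.log 2 ≤ L + 2 :=
      mul_le_of_le_one_right (by positivity) hl2
    have h3 : ε ^ 2 * k = 2 * l := by rw [hε, hkr]; field_simp; norm_num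
    rw [h3]
    linarith
  obtain ⟨T, hTc, hTp⟩ := exists_almost_periods B hB f hf0 hf1 (by positivity : 0 < ε) k hk1 hlog
  have hT0 : (0 : ℝ) < T.card := lt_of_lt_of_le (by positivity) hTc
  have hT : T.Nonempty := Finset.card_pos.1 (by exact_mod_cast hT0)
  obtain ⟨W, hW, hWv⟩ := exists_subspace_smoothed (F := F) B T hB hT f hf0 hf1 l
  refine ⟨W, ?_, ?_⟩
  · have h1 : (Fintype.card V : ℝ) / T.card ≤ 2 ^ (L * k + 1) := by
      rw [div_le_iff₀ hT0]
      have h2 : (1 : ℝ) ≤ 2 ^ (L * k) * ((B.card : ℝ) / Fintype.card V) ^ k := by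
        rw [pow_mul, ← mul_pow]
        refine one_le_pow₀ ?_
        rw [mul_div_assoc', le_div_iff₀ hV]
        linarith
      calc (Fintype.card V : ℝ) ≤
            2 ^ (L * k) * ((B.card : ℝ) / Fintype.card V) ^ k * Fintype.card V :=
            le_mul_of_one_le_left hV.le h2
        _ = 2 ^ (L * k + 1) * (((B.card : ℝ) / Fintype.card V) ^ k / 2 * Fintype.card V) := by ring
        _ ≤ _ := by gcongr
    have h2 := Real.log_le_log (by positivity) h1
    rw [Real.log_pow] at h2
    push_cast at h2
    have h3 : ((L : ℝ) * k + 1) * Real.log 2 ≤ L * k + 1 :=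
      mul_le_of_le_one_right (by positivity) hl2
    have h4 : 8 * Real.log (Fintype.card V / T.card) ≤ 2 ^ 20 * (l : ℝ) ^ 4 := by
      have : 2 ^ 20 * (l : ℝ) ^ 4 = 8 * ((L + 4) * k) := by rw [hkr, hlr]; ring
      rw [this]
      linarith
    have h5 : (Module.finrank F V : ℝ) ≤
        ((Module.finrank F W + 2 ^ 20 * l ^ 4 : ℕ) : ℝ) := by push_cast; linarith
    exact_mod_cast h5
  · intro v hv
    have h1 := abs_le.1 (hWv v hv)
    have h2 := abs_iterate_diffAvg_sub_le T hT (diffAvg B f) (fun t ht t' ht' => hTp t ht t' ht') l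
    have h3 := abs_le.1 (h2 v)
    have h4 := abs_le.1 (h2 0)
    have h5 : (l : ℝ) * (2 * ε) = 1 / 128 := by rw [hε]; field_simp; norm_num
    have h6 : 2 * (1 / 4 : ℝ) ^ l * (Fintype.card V / B.card) ≤ 1 / 128 := by
      have h7 : (1 : ℝ) ≤ 2 ^ L := one_le_pow₀ (by norm_num)
      have h8 : (4 : ℝ) ^ l = 2 ^ L * 2 ^ L * 256 := by
        rw [hl, pow_add, show (4 : ℝ) = 2 * 2 by norm_num, mul_pow]; norm_num
      calc 2 * (1 / 4 : ℝ) ^ l * (Fintype.card V / B.card) ≤ 2 * (1 / 4 : ℝ) ^ l * 2 ^ L := by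
            gcongr
        _ = (1 / 128) * (1 / 2 ^ L) := by rw [div_pow, h8]; field_simp; norm_num
        _ ≤ (1 / 128) * 1 := by
            gcongr
            rw [div_le_one (by positivity)]; exact h7
        _ = _ := by norm_num
    rw [h5] at h3 h4
    linarith [h1.1, h3.2, h4.1]

/-- The Kelley–Meka density increment: either `A + A + A` is everything, or `A` has increased
density on a coset of a large subspace. -/
theorem exists_density_increment (A : Finset V) (hA : A.Nonempty) {p D : ℕ} (hpe : Even p)
    (hp : 1 + 64 * ((9 / 8 : ℝ) ^ 4) ^ p ≤ 2 ^ p) (hDp : D ≤ p)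
    (hD : (Fintype.card V : ℝ) ≤ 2 ^ D * A.card) (h3 : A + A + A ≠ Finset.univ) :
    ∃ (W : Submodule F V) (x : V),
      Module.finrank F V ≤ Module.finrank F W + 2 ^ 20 * (D * (4 * p) + 4) ^ 4 ∧
      17 / 16 * ((A.card : ℝ) / Fintype.card V) * (Nat.card W : ℝ) ≤
        Nat.card {w : W // x + (w : V) ∈ A} := by
  classical
  have hV : (0 : ℝ) < Fintype.card V := by exact_mod_cast Fintype.card_pos
  have hA0 : (0 : ℝ) < A.card := by exact_mod_cast hA.card_pos
  obtain ⟨x, hx⟩ : ∃ x, x ∉ A + A + A := by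
    by_contra! h
    exact h3 (Finset.eq_univ_iff_forall.2 h)
  set N : ℝ := (Fintype.card V : ℝ) with hN
  set c : ℝ := (A.card : ℝ) ^ 2 / N with hc
  have hc0 : 0 < c := by positivity
  have hm : 2 ^ p * c ^ (4 * p) * N ≤ ∑ y, autocorr (indic A) y ^ (4 * p) := by
    refine le_trans ?_ (large_moment_of_notMem A hpe hx)
    have h1 : N ≤ 2 ^ p * A.card := hD.trans (by gcongr; norm_num)
    calc 2 ^ p * c ^ (4 * p) * N ≤ 2 ^ p * c ^ (4 * p) * (2 ^ p * A.card) := by gcongr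
      _ = 4 ^ p * c ^ (4 * p) * A.card := by
          rw [show (4 : ℝ) = 2 * 2 by norm_num, mul_pow]; ring
  obtain ⟨B, hBc, hBS⟩ := exists_dense_popular A hA hp hm
    (Finset.univ.filter fun x => 9 / 8 * c ≤ autocorr (indic A) x) (by simp [hc, hN])
  set S := Finset.univ.filter fun x => 9 / 8 * c ≤ autocorr (indic A) x with hS
  have hB0 : (0 : ℝ) < B.card := lt_of_lt_of_le (by positivity) hBc
  have hB : B.Nonempty := Finset.card_pos.1 (by exact_mod_cast hB0)
  have hL : N ≤ 2 ^ (D * (4 * p)) * B.card := by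
    have h1 : (1 : ℝ) ≤ 2 ^ (D * (4 * p)) * ((A.card : ℝ) / N) ^ (4 * p) := by
      rw [pow_mul, ← mul_pow]
      refine one_le_pow₀ ?_
      rw [mul_div_assoc', le_div_iff₀ hV]
      linarith
    calc N ≤ 2 ^ (D * (4 * p)) * ((A.card : ℝ) / N) ^ (4 * p) * N :=
          le_mul_of_one_le_left hV.le h1
      _ = 2 ^ (D * (4 * p)) * (((A.card : ℝ) / N) ^ (4 * p) * N) := by ring
      _ ≤ _ := by gcongr
  obtain ⟨W, hW, hWv⟩ := exists_subspace_popular (F := F) B (indic S) hB (indic_nonneg S)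
    (indic_le_one S) _ hL
  have h0 : 1 - 1 / 64 ≤ diffAvg B (indic S) 0 := by
    rw [diffAvg, le_div_iff₀ (by positivity)]
    simpa using hBS
  by_contra! hcon
  have hW0 : (0 : ℝ) < Nat.card W := by exact_mod_cast Nat.card_pos
  set M : ℝ := 17 / 16 * c * Nat.card W with hM
  have h1 : ∀ y, ∑ w : W, autocorr (indic A) (w + y) < M := by
    intro y
    have h2 : ∀ z, ∑ w : W, indic A (z + (w + y)) = Nat.card {w : W // (z + y) + (w : V) ∈ A} := by
      intro z
      rw [Nat.card_eq_fintype_card, Fintype.card_subtype]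
      simp [indic, add_comm y, add_assoc]
    have h4 : ∑ w : W, autocorr (indic A) (w + y) =
        ∑ z ∈ A, (Nat.card {w : W // (z + y) + (w : V) ∈ A} : ℝ) := by
      simp_rw [autocorr, sum_indic_mul]
      rw [Finset.sum_comm]
      exact Finset.sum_congr rfl fun z _ => h2 z
    rw [h4]
    calc ∑ z ∈ A, (Nat.card {w : W // (z + y) + (w : V) ∈ A} : ℝ)
        < ∑ z ∈ A, 17 / 16 * ((A.card : ℝ) / N) * Nat.card W :=
          Finset.sum_lt_sum_of_nonempty hA fun z _ => hcon W (z + y) hW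
      _ = M := by simp [hM, hc]; ring
  have h2 : ∑ w : W, diffAvg B (autocorr (indic A)) w < M := by
    simp_rw [diffAvg]
    rw [← Finset.sum_div, div_lt_iff₀ (by positivity), Finset.sum_comm]
    calc ∑ a ∈ B, ∑ w : W, ∑ b ∈ B, autocorr (indic A) (w + (b - a))
        = ∑ a ∈ B, ∑ b ∈ B, ∑ w : W, autocorr (indic A) (w + (b - a)) :=
          Finset.sum_congr rfl fun a _ => Finset.sum_comm
      _ < ∑ a ∈ B, ∑ b ∈ B, M :=
          Finset.sum_lt_sum_of_nonempty hB fun a _ => Finset.sum_lt_sum_of_nonempty hB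
            fun b _ => h1 _
      _ = _ := by simp; ring
  have h4 : ∀ w : W, 17 / 16 * c ≤ diffAvg B (autocorr (indic A)) w := by
    intro w
    have h5 := hWv w w.2
    have h6 : 9 / 8 * c * diffAvg B (indic S) w ≤ diffAvg B (autocorr (indic A)) w := by
      rw [diffAvg, diffAvg, mul_div_assoc', Finset.mul_sum]
      gcongr with a _
      rw [Finset.mul_sum]
      gcongr with b _
      rw [indic]
      split_ifs with h
      · rw [mul_one]; exact (Finset.mem_filter.1 h).2
      · rw [mul_zero]
        exact Finset.sum_nonneg fun _ _ => mul_nonneg (indic_nonneg _ _) (indic_nonneg _ _)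
    nlinarith
  have h5 := Finset.sum_le_sum fun (w : W) (_ : w ∈ Finset.univ) => h4 w
  simp only [Finset.sum_const, Finset.card_univ, nsmul_eq_mul] at h5
  rw [hM, Nat.card_eq_fintype_card] at h2
  linarith

end Increment

/-- Iterating the density increment: a set of density at least `α` can be improved at most `m` times
by the factor `17 / 16` if `1 < α * (17 / 16) ^ m`, so it contains a large piece of a coset whose
triple sumset is a full coset. -/
theorem exists_subset_triple_sum_affine (F : Type*) [Field F] [Fintype F] {p D : ℕ} (hpe : Even p)
    (hp : 1 + 64 * ((9 / 8 : ℝ) ^ 4) ^ p ≤ 2 ^ p) (hDp : D ≤ p) (m : ℕ) :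
    ∀ {V : Type*} [AddCommGroup V] [Module F V] [Fintype V] [DecidableEq V] (A : Finset V) (α : ℝ),
      1 < α * (17 / 16) ^ m → α * Fintype.card V ≤ A.card →
      (Fintype.card V : ℝ) ≤ 2 ^ D * A.card →
      ∃ A' ⊆ A, (Fintype.card V : ℝ) ≤
          2 ^ D * (Fintype.card F : ℝ) ^ (2 ^ 20 * (D * (4 * p) + 4) ^ 4 * m) * A'.card ∧
        ∃ (W : Submodule F V) (θ : V),
          (↑(A' + A' + A') : Set V) = {θ} + (W : Set V) := by
  obtain ⟨K, hK⟩ : ∃ K : ℕ, K = 2 ^ 20 * (D * (4 * p) + 4) ^ 4 := ⟨_, rfl⟩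
  rw [← hK]
  induction m with
  | zero =>
    intro V _ _ _ _ A α h1 h2 _
    have hV : (0 : ℝ) < Fintype.card V := by exact_mod_cast Fintype.card_pos
    have h3 : (A.card : ℝ) ≤ Fintype.card V := by exact_mod_cast A.card_le_univ
    rw [pow_zero, mul_one] at h1
    nlinarith
  | succ m ih =>
    intro V _ _ _ _ A α h1 h2 hD
    have hV : (0 : ℝ) < Fintype.card V := by exact_mod_cast Fintype.card_pos
    have hF1 : (1 : ℝ) ≤ Fintype.card F := by exact_mod_cast Fintype.card_pos
    by_cases h3 : A + A + A = Finset.univ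
    · refine ⟨A, subset_rfl, ?_, ⊤, 0, by simp [h3]⟩
      refine hD.trans ?_
      have : (1 : ℝ) ≤ (Fintype.card F : ℝ) ^ (K * (m + 1)) := one_le_pow₀ hF1
      gcongr
      exact le_mul_of_one_le_right (by positivity) this
    · have hA : A.Nonempty := by
        rw [← Finset.card_pos]
        by_contra h
        have : A.card = 0 := by omega
        rw [this] at hD
        simp at hD
      obtain ⟨W, x, hW, hWx⟩ := exists_density_increment (F := F) A hA hpe hp hDp hD h3
      rw [← hK] at hW
      have : Fintype W := Fintype.ofFinite W
      set A₁ : Finset W := Finset.univ.filter fun w => x + (w : V) ∈ A with hA₁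
      have hA₁c : Nat.card {w : W // x + (w : V) ∈ A} = A₁.card := by
        rw [Nat.card_eq_fintype_card, Fintype.card_subtype]
      rw [hA₁c, Nat.card_eq_fintype_card] at hWx
      have hα : α ≤ (A.card : ℝ) / Fintype.card V := (le_div_iff₀ hV).2 h2
      have hWpos : (0 : ℝ) < Fintype.card W := by exact_mod_cast Fintype.card_pos
      obtain ⟨A₂, hA₂, hA₂c, W', θ, hsum⟩ := ih A₁ (α * (17 / 16)) (by rw [pow_succ] at h1; linarith)
        (by
          refine le_trans ?_ hWx
          exact mul_le_mul_of_nonneg_right (by linarith) hWpos.le)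
        (by
          have h4 : (1 : ℝ) ≤ 2 ^ D * ((A.card : ℝ) / Fintype.card V) := by
            rw [mul_div_assoc', le_div_iff₀ hV]; linarith
          have h5 : (1 : ℝ) * Fintype.card W ≤
              2 ^ D * ((A.card : ℝ) / Fintype.card V) * Fintype.card W := by gcongr
          have h6 : 2 ^ D * (17 / 16 * ((A.card : ℝ) / Fintype.card V) * Fintype.card W) ≤
            2 ^ D * (A₁.card : ℝ) := by gcongr
          nlinarith)
      have hcard : (Fintype.card V : ℝ) ≤ (Fintype.card F : ℝ) ^ K * Fintype.card W := by
        rw [Module.card_eq_pow_finrank (K := F) (V := V), Module.card_eq_pow_finrank (K := F) (V := W)]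
        push_cast
        rw [← pow_add]
        exact pow_le_pow_right₀ hF1 (by omega)
      refine ⟨A₂.image (fun w : W => x + (w : V)), ?_, ?_, W'.map W.subtype, x + x + x + θ, ?_⟩
      · intro v hv
        obtain ⟨w, hw, rfl⟩ := Finset.mem_image.1 hv
        exact (Finset.mem_filter.1 (hA₂ hw)).2
      · rw [Finset.card_image_of_injective _ (fun a b h => by simpa using h)]
        calc (Fintype.card V : ℝ) ≤ (Fintype.card F : ℝ) ^ K * Fintype.card W := hcard
          _ ≤ (Fintype.card F : ℝ) ^ K *
              (2 ^ D * (Fintype.card F : ℝ) ^ (K * m) * A₂.card) := by gcongr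
          _ = _ := by ring
      · have h4 : ∀ w : W, w ∈ A₂ + A₂ + A₂ ↔ ∃ u ∈ W', θ + u = w := by
          intro w
          rw [← Finset.mem_coe, hsum, Set.mem_add]
          simp only [Set.mem_singleton_iff, exists_eq_left, SetLike.mem_coe]
        ext v
        simp only [Finset.coe_add, Set.mem_add, Set.mem_singleton_iff, exists_eq_left,
          Finset.coe_image, Set.mem_image, SetLike.mem_coe, Submodule.mem_map]
        constructor
        · rintro ⟨_, ⟨_, ⟨a, ha, rfl⟩, _, ⟨b, hb, rfl⟩, rfl⟩, _, ⟨c, hc, rfl⟩, rfl⟩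
          obtain ⟨u, hu, huw⟩ := (h4 _).1 (Finset.add_mem_add (Finset.add_mem_add ha hb) hc)
          refine ⟨u, ⟨u, hu, rfl⟩, ?_⟩
          have := congrArg (Subtype.val) huw
          simp only [Submodule.coe_add] at this
          rw [add_assoc, this]
          abel
        · rintro ⟨_, ⟨u, hu, rfl⟩, rfl⟩
          obtain ⟨s, hs, c, hc, hsc⟩ := Finset.mem_add.1 ((h4 _).2 ⟨u, hu, rfl⟩)
          obtain ⟨a, ha, b, hb, rfl⟩ := Finset.mem_add.1 hs
          refine ⟨_, ⟨_, ⟨a, ha, rfl⟩, _, ⟨b, hb, rfl⟩, rfl⟩, _, ⟨c, hc, rfl⟩, ?_⟩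
          have := congrArg (Subtype.val) hsc
          simp only [Submodule.coe_add] at this
          rw [Submodule.subtype_apply, add_assoc _ (θ : V), ← this]
          abel

theorem one_add_moment_const_le {D : ℕ} (hD : 1 ≤ D) :
    1 + 64 * ((9 / 8 : ℝ) ^ 4) ^ (32 * D) ≤ 2 ^ (32 * D) := by
  have h1 : (1 : ℝ) ≤ ((9 / 8 : ℝ) ^ 4) ^ (32 * D) := one_le_pow₀ (by norm_num)
  calc 1 + 64 * ((9 / 8 : ℝ) ^ 4) ^ (32 * D) ≤ 65 * ((9 / 8 : ℝ) ^ 4) ^ (32 * D) := by linarith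
    _ ≤ 65 ^ D * ((9 / 8 : ℝ) ^ 4) ^ (32 * D) := by
        gcongr
        exact le_self_pow₀ (by norm_num) (by omega)
    _ = (65 * ((9 / 8 : ℝ) ^ 4) ^ 32) ^ D := by rw [pow_mul, mul_pow]
    _ ≤ (2 ^ 32) ^ D := by gcongr; norm_num
    _ = _ := by rw [← pow_mul]

theorem add_codim_le {D : ℕ} (hD : 1 ≤ D) :
    D + 2 ^ 20 * (D * (4 * (32 * D)) + 4) ^ 4 * (13 * D) ≤ 2 ^ 54 * D ^ 9 := by
  have h1 : D * (4 * (32 * D)) + 4 ≤ 132 * D ^ 2 := by nlinarith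
  have h2 : D ≤ D ^ 9 := le_self_pow₀ hD (by norm_num)
  calc D + 2 ^ 20 * (D * (4 * (32 * D)) + 4) ^ 4 * (13 * D)
      ≤ D ^ 9 + 2 ^ 20 * (132 * D ^ 2) ^ 4 * (13 * D) := by gcongr
    _ = (1 + 2 ^ 20 * 132 ^ 4 * 13) * D ^ 9 := by ring
    _ ≤ _ := by gcongr; norm_num

/-- A large subset `A' ⊆ A` whose triple sumset `A' + A' + A'` is an affine subspace. -/
theorem exact_bogolyubov_3A :
    ∃ C : ℝ, 1 ≤ C ∧ ∀ (F : Type) [Field F] [Fintype F] [DecidableEq F] (n : ℕ), 1 ≤ n →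
      ∀ d : ℝ, 1 ≤ d → ∀ A : Finset (Fin n → F),
      (2:ℝ) ^ (-d) * (Fintype.card F : ℝ) ^ n ≤ A.card →
      ∃ A' : Finset (Fin n → F), A' ⊆ A ∧
        (Fintype.card F : ℝ) ^ (-(C * d ^ 9)) * (Fintype.card F : ℝ) ^ n ≤ (A'.card : ℝ) ∧
        ∃ (W : Submodule F (Fin n → F)) (θ : Fin n → F),
          (↑(A' + A' + A') : Set (Fin n → F)) = {θ} + (W : Set (Fin n → F)) := by
  refine ⟨2 ^ 63, by norm_num, ?_⟩
  intro F _ _ _ n _ d hd A hA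
  obtain ⟨D, hDd, hdD, hD1⟩ : ∃ D : ℕ, d ≤ D ∧ (D : ℝ) ≤ 2 * d ∧ 1 ≤ D := by
    refine ⟨⌈d⌉₊, Nat.le_ceil d, ?_, Nat.one_le_ceil_iff.2 (by linarith)⟩
    linarith [Nat.ceil_lt_add_one (by linarith : 0 ≤ d)]
  have hq : (2 : ℝ) ≤ Fintype.card F := by exact_mod_cast Fintype.one_lt_card
  have hV : (Fintype.card (Fin n → F) : ℝ) = (Fintype.card F : ℝ) ^ n := by simp
  have hdens : (2 ^ D : ℝ)⁻¹ * Fintype.card (Fin n → F) ≤ A.card := by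
    refine le_trans ?_ hA
    rw [hV]
    gcongr
    rw [← Real.rpow_natCast, ← Real.rpow_neg (by norm_num)]
    exact Real.rpow_le_rpow_of_exponent_le (by norm_num) (by linarith)
  have hm : 1 < (2 ^ D : ℝ)⁻¹ * (17 / 16) ^ (13 * D) := by
    rw [← inv_pow, pow_mul, ← mul_pow]
    exact one_lt_pow₀ (by norm_num) (by omega)
  obtain ⟨A', hA', hc, hW⟩ := exists_subset_triple_sum_affine F (p := 32 * D) (D := D)
    ((by decide : Even 32).mul_right D) (one_add_moment_const_le hD1) (by omega) (13 * D) A _ hm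
    hdens ((inv_mul_le_iff₀ (by positivity)).1 hdens)
  refine ⟨A', hA', ?_, hW⟩
  rw [Real.rpow_neg (by positivity), inv_mul_le_iff₀ (by positivity), ← hV]
  refine hc.trans ?_
  gcongr
  have hexp : ((2 ^ 54 * D ^ 9 : ℕ) : ℝ) ≤ 2 ^ 63 * d ^ 9 := by
    rw [Nat.cast_mul, Nat.cast_pow, Nat.cast_pow, Nat.cast_ofNat]
    calc (2 : ℝ) ^ 54 * D ^ 9 ≤ 2 ^ 54 * (2 * d) ^ 9 := by gcongr
      _ = 2 ^ 63 * d ^ 9 := by ring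
  calc (2 : ℝ) ^ D * (Fintype.card F : ℝ) ^ (2 ^ 20 * (D * (4 * (32 * D)) + 4) ^ 4 * (13 * D))
      ≤ (Fintype.card F : ℝ) ^ D *
        (Fintype.card F : ℝ) ^ (2 ^ 20 * (D * (4 * (32 * D)) + 4) ^ 4 * (13 * D)) := by gcongr
    _ = (Fintype.card F : ℝ) ^ (D + 2 ^ 20 * (D * (4 * (32 * D)) + 4) ^ 4 * (13 * D)) :=
        (pow_add _ _ _).symm
    _ ≤ (Fintype.card F : ℝ) ^ (2 ^ 54 * D ^ 9) :=
        pow_le_pow_right₀ (by linarith) (add_codim_le hD1)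
    _ = (Fintype.card F : ℝ) ^ ((2 ^ 54 * D ^ 9 : ℕ) : ℝ) := (Real.rpow_natCast _ _).symm
    _ ≤ _ := Real.rpow_le_rpow_of_exponent_le (by linarith) hexp
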